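/- Let l > 0, λ₊ > 0, λ₋ > 0, and ε ∈ (0,1). There exists δ > 0 depending only on l, λ₊, λ₋, ε such that every minimizer u of J(C_1, λ₊, λ₋) on the cone of length l with |u| < δ everywhere on C_ε satisfies u ≡ 0 on C_{ε/2}. -/

import Mathlib

open MeasureTheory Set

noncomputable section

/-- The cone distance on the cone of length `l`, in polar coordinates:
`d((r,θ),(s,φ)) = sqrt(r² + s² − 2 r s cos(min(δ, π)))` with
`δ = min_{k ∈ ℤ} |θ − φ + k l|`. -/
def coneDist (l : ℝ) (p q : ℝ × ℝ) : ℝ :=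
  Real.sqrt (p.1 ^ 2 + q.1 ^ 2 -
    2 * p.1 * q.1 * Real.cos (min (⨅ k : ℤ, |p.2 - q.2 + (k : ℝ) * l|) Real.pi))

/-- A Lipschitz function on the cone ball `C_R` of the cone of length `l`, given in
polar coordinates: `l`-periodic in `θ` and Lipschitz for the cone distance (this forces
a well-defined vertex value `u 0 _` and continuity at the vertex). -/
structure ConeLip (l R : ℝ) (u : ℝ → ℝ → ℝ) : Prop where
  periodic : ∀ r θ : ℝ, u r (θ + l) = u r θ
  lipschitz : ∃ K : ℝ, ∀ p q : ℝ × ℝ, p.1 ∈ Set.Icc 0 R → q.1 ∈ Set.Icc 0 R →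
    |u p.1 p.2 - u q.1 q.2| ≤ K * coneDist l p q

/-- The squared cone gradient `|Du|² = (∂_r u)² + (∂_θ u)²/r²` at a polar point,
computed from Lean's a.e.-defined derivatives. -/
def gradSq (u : ℝ → ℝ → ℝ) (p : ℝ × ℝ) : ℝ :=
  (deriv (fun s => u s p.2) p.1) ^ 2 + (deriv (fun φ => u p.1 φ) p.2) ^ 2 / p.1 ^ 2

/-- The two-phase functional
`J(u, C_R) = ∫_{C_R} |Du|² + λ₊ area({u > 0} ∩ C_R) + λ₋ area({u < 0} ∩ C_R)`,
computed in polar coordinates with area measure `r dr dθ`, `θ` ranging over `(0, l)`. -/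
def Jfun (l lp lm : ℝ) (u : ℝ → ℝ → ℝ) (R : ℝ) : ℝ :=
  ∫ p in Set.Ioo (0:ℝ) R ×ˢ Set.Ioo (0:ℝ) l,
    (gradSq u p + (if 0 < u p.1 p.2 then lp else 0)
      + (if u p.1 p.2 < 0 then lm else 0)) * p.1

/-- The Dirichlet energy `∫_{C_R} |Du|²` with respect to the area measure `r dr dθ`. -/
def Dir (l : ℝ) (u : ℝ → ℝ → ℝ) (R : ℝ) : ℝ :=
  ∫ p in Set.Ioo (0:ℝ) R ×ˢ Set.Ioo (0:ℝ) l, gradSq u p * p.1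

/-- `u` is a minimizer of `J(C_R, λ₊, λ₋)` on the cone of length `l`: a cone Lipschitz
function beating every cone Lipschitz competitor with the same boundary values on
`{r = R}`. -/
def IsMinimizerJ (l lp lm R : ℝ) (u : ℝ → ℝ → ℝ) : Prop :=
  ConeLip l R u ∧ ∀ w : ℝ → ℝ → ℝ, ConeLip l R w → (∀ θ : ℝ, w R θ = u R θ) →
    Jfun l lp lm u R ≤ Jfun l lp lm w R

/-! ### Basic facts on the cone distance and cone-Lipschitz functions -/

lemma iInf_nonneg_aux (l a : ℝ) : 0 ≤ ⨅ k : ℤ, |a + (k : ℝ) * l| :=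
  Real.iInf_nonneg fun _ => abs_nonneg _

lemma iInf_le_aux (l a : ℝ) : (⨅ k : ℤ, |a + (k : ℝ) * l|) ≤ |a| := by
  have h : BddBelow (Set.range fun k : ℤ => |a + (k : ℝ) * l|) :=
    ⟨0, by rintro _ ⟨k, rfl⟩; exact abs_nonneg _⟩
  simpa using ciInf_le h 0

lemma coneDist_radial (l r s θ : ℝ) : coneDist l (r, θ) (s, θ) = |r - s| := by
  have h0 : (⨅ k : ℤ, |θ - θ + (k : ℝ) * l|) = 0 := by
    apply le_antisymm
    · simpa using iInf_le_aux l (θ - θ)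
    · exact iInf_nonneg_aux l _
  unfold coneDist
  simp only [h0]
  rw [min_eq_left Real.pi_pos.le, Real.cos_zero, ← Real.sqrt_sq_eq_abs]
  congr 1
  ring

lemma coneDist_angular (l r θ φ : ℝ) (hr : 0 ≤ r) :
    coneDist l (r, θ) (r, φ) ≤ r * |θ - φ| := by
  unfold coneDist
  simp only
  set m := min (⨅ k : ℤ, |θ - φ + (k : ℝ) * l|) Real.pi with hm
  have hm0 : 0 ≤ m := le_min (iInf_nonneg_aux l _) Real.pi_pos.le
  have hm1 : m ≤ |θ - φ| := (min_le_left _ _).trans (iInf_le_aux l _)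
  have hc := Real.one_sub_sq_div_two_le_cos (x := m)
  apply Real.sqrt_le_iff.2
  refine ⟨by positivity, ?_⟩
  have h2 : m ^ 2 ≤ |θ - φ| ^ 2 := by gcongr
  have h3 : r ^ 2 * m ^ 2 ≤ r ^ 2 * |θ - φ| ^ 2 := by gcongr
  have h4 : r ^ 2 * (1 - m ^ 2 / 2) ≤ r ^ 2 * Real.cos m := by gcongr
  nlinarith

lemma abs_sub_le_coneDist (l : ℝ) (p q : ℝ × ℝ) (hp : 0 ≤ p.1) (hq : 0 ≤ q.1) :
    |p.1 - q.1| ≤ coneDist l p q := by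
  unfold coneDist
  rw [← Real.sqrt_sq_eq_abs]
  apply Real.sqrt_le_sqrt
  have := Real.cos_le_one (min (⨅ k : ℤ, |p.2 - q.2 + (k : ℝ) * l|) Real.pi)
  have h2 : p.1 * q.1 * Real.cos (min (⨅ k : ℤ, |p.2 - q.2 + (k : ℝ) * l|) Real.pi)
      ≤ p.1 * q.1 * 1 := mul_le_mul_of_nonneg_left this (mul_nonneg hp hq)
  nlinarith

lemma coneDist_nonneg (l : ℝ) (p q : ℝ × ℝ) : 0 ≤ coneDist l p q := Real.sqrt_nonneg _

/-- Polar Lipschitz bounds with constant `K ≥ 0`. -/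
structure PolLip (K : ℝ) (u : ℝ → ℝ → ℝ) : Prop where
  nonneg : 0 ≤ K
  rad : ∀ r ∈ Icc (0:ℝ) 1, ∀ s ∈ Icc (0:ℝ) 1, ∀ θ, |u r θ - u s θ| ≤ K * |r - s|
  ang : ∀ r ∈ Icc (0:ℝ) 1, ∀ θ φ, |u r θ - u r φ| ≤ K * r * |θ - φ|

lemma ConeLip.exists_polLip {l : ℝ} {u : ℝ → ℝ → ℝ} (h : ConeLip l 1 u) :
    ∃ K, PolLip K u ∧ ∀ p q : ℝ × ℝ, p.1 ∈ Set.Icc (0:ℝ) 1 → q.1 ∈ Set.Icc (0:ℝ) 1 →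
    |u p.1 p.2 - u q.1 q.2| ≤ K * coneDist l p q := by
  obtain ⟨K, hK⟩ := h.lipschitz
  have hK' : ∀ p q : ℝ × ℝ, p.1 ∈ Set.Icc (0:ℝ) 1 → q.1 ∈ Set.Icc (0:ℝ) 1 →
      |u p.1 p.2 - u q.1 q.2| ≤ max K 0 * coneDist l p q := fun p q hp hq =>
    (hK p q hp hq).trans
      (mul_le_mul_of_nonneg_right (le_max_left _ _) (coneDist_nonneg l p q))
  refine ⟨max K 0, ⟨le_max_right _ _, ?_, ?_⟩, hK'⟩
  · intro r hr s hs θ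
    have := hK' (r, θ) (s, θ) hr hs
    rwa [coneDist_radial] at this
  · intro r hr θ φ
    have := hK' (r, θ) (r, φ) hr hr
    refine this.trans ?_
    rw [mul_assoc]
    exact mul_le_mul_of_nonneg_left (coneDist_angular l r θ φ hr.1) (le_max_right _ _)

namespace PolLip

variable {K : ℝ} {u : ℝ → ℝ → ℝ}

lemma joint (h : PolLip K u) {r s : ℝ} (hr : r ∈ Icc (0:ℝ) 1) (hs : s ∈ Icc (0:ℝ) 1)
    (θ φ : ℝ) : |u r θ - u s φ| ≤ K * |r - s| + K * |θ - φ| := by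
  have h1 := h.rad r hr s hs θ
  have h2 := h.ang s hs θ φ
  have h3 : K * s * |θ - φ| ≤ K * |θ - φ| := by
    apply mul_le_mul_of_nonneg_right _ (abs_nonneg _)
    have := mul_le_mul_of_nonneg_left hs.2 h.nonneg
    simpa using this
  calc |u r θ - u s φ| ≤ |u r θ - u s θ| + |u s θ - u s φ| := abs_sub_le _ _ _
    _ ≤ _ := by linarith

/-- clamp to the unit interval -/
def clamp (r : ℝ) : ℝ := max 0 (min r 1)

lemma clamp_mem (r : ℝ) : clamp r ∈ Icc (0:ℝ) 1 :=
  ⟨le_max_left _ _, max_le zero_le_one (min_le_right _ _)⟩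

lemma clamp_eq {r : ℝ} (hr : r ∈ Icc (0:ℝ) 1) : clamp r = r := by
  unfold clamp; rw [min_eq_left hr.2, max_eq_right hr.1]

lemma continuous_clamp : Continuous clamp := by unfold clamp; fun_prop

lemma continuous_ext (h : PolLip K u) : Continuous fun p : ℝ × ℝ => u (clamp p.1) p.2 := by
  rw [continuous_iff_continuousAt]
  intro q
  unfold ContinuousAt
  rw [tendsto_iff_dist_tendsto_zero]
  have hc : Filter.Tendsto (fun p : ℝ × ℝ => K * |clamp p.1 - clamp q.1| + K * |p.2 - q.2|)
      (nhds q) (nhds 0) := by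
    have : Continuous (fun p : ℝ × ℝ => K * |clamp p.1 - clamp q.1| + K * |p.2 - q.2|) := by
      have := continuous_clamp
      fun_prop
    have := this.tendsto q
    simpa using this
  refine squeeze_zero (fun _ => dist_nonneg) (fun p => ?_) hc
  rw [Real.dist_eq]
  exact h.joint (clamp_mem _) (clamp_mem _) _ _

lemma continuousOn (h : PolLip K u) :
    ContinuousOn (fun p : ℝ × ℝ => u p.1 p.2) (Icc (0:ℝ) 1 ×ˢ univ) := by
  refine h.continuous_ext.continuousOn.congr ?_
  rintro ⟨r, θ⟩ ⟨hr, -⟩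
  simp only at hr ⊢
  rw [clamp_eq hr]

lemma continuousAt_rad (h : PolLip K u) {r : ℝ} (hr : r ∈ Ioo (0:ℝ) 1) (θ : ℝ) :
    ContinuousAt (fun s => u s θ) r := by
  have h1 : ContinuousAt (fun s => u (clamp s) θ) r :=
    (h.continuous_ext.comp (Continuous.prodMk_left θ)).continuousAt
  refine h1.congr ?_
  filter_upwards [Ioo_mem_nhds hr.1 hr.2] with s hs
  rw [clamp_eq (Ioo_subset_Icc_self hs)]

lemma continuous_ang (h : PolLip K u) {r : ℝ} (hr : r ∈ Icc (0:ℝ) 1) :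
    Continuous (fun φ => u r φ) := by
  have h1 : Continuous (fun φ => u (clamp r) φ) :=
    (h.continuous_ext.comp (Continuous.prodMk_right r))
  rwa [clamp_eq hr] at h1

lemma gradSq_ext {r θ : ℝ} (hr : r ∈ Ioo (0:ℝ) 1) :
    gradSq (fun s φ => u (clamp s) φ) (r, θ) = gradSq u (r, θ) := by
  unfold gradSq
  simp only
  rw [clamp_eq (Ioo_subset_Icc_self hr)]
  congr 2
  apply Filter.EventuallyEq.deriv_eq
  filter_upwards [Ioo_mem_nhds hr.1 hr.2] with s hs
  rw [clamp_eq (Ioo_subset_Icc_self hs)]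

lemma measurable_gradSq_ext (h : PolLip K u) :
    Measurable (gradSq (fun s φ => u (clamp s) φ)) := by
  unfold gradSq
  have h1 : Measurable (fun p : ℝ × ℝ => deriv (fun φ => u (clamp p.1) φ) p.2) :=
    measurable_deriv_with_param (f := fun s φ => u (clamp s) φ) h.continuous_ext
  have h2 : Measurable (fun p : ℝ × ℝ => deriv (fun s => u (clamp s) p.1) p.2) :=
    measurable_deriv_with_param (f := fun φ s => u (clamp s) φ)
      (h.continuous_ext.comp continuous_swap)
  have h3 : Measurable (fun p : ℝ × ℝ => deriv (fun s => u (clamp s) p.2) p.1) :=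
    h2.comp measurable_swap
  exact (h3.pow_const 2).add ((h1.pow_const 2).div (measurable_fst.pow_const 2))

lemma gradSq_nonneg (u : ℝ → ℝ → ℝ) (p : ℝ × ℝ) : 0 ≤ gradSq u p := by
  unfold gradSq; positivity

lemma gradSq_le (h : PolLip K u) {r θ : ℝ} (hr : r ∈ Ioo (0:ℝ) 1) :
    gradSq u (r, θ) ≤ 2 * K ^ 2 := by
  have hK := h.nonneg
  have hrI := Ioo_subset_Icc_self hr
  have hr0 : 0 < r := hr.1
  have h1 : ‖deriv (fun s => u s θ) r‖ ≤ K := by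
    apply norm_deriv_le_of_lip' hK
    filter_upwards [Ioo_mem_nhds hr.1 hr.2] with s hs
    exact h.rad s (Ioo_subset_Icc_self hs) r hrI θ
  have h2 : ‖deriv (fun φ => u r φ) θ‖ ≤ K * r := by
    apply norm_deriv_le_of_lip' (by positivity)
    filter_upwards with φ
    exact h.ang r hrI φ θ
  rw [Real.norm_eq_abs] at h1 h2
  have h1' : (deriv (fun s => u s θ) r) ^ 2 ≤ K ^ 2 := by
    rw [← sq_abs]; gcongr
  have h2' : (deriv (fun φ => u r φ) θ) ^ 2 / r ^ 2 ≤ K ^ 2 := by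
    rw [div_le_iff₀ (by positivity), ← mul_pow, ← sq_abs]; gcongr
  unfold gradSq
  simp only
  linarith

end PolLip

/-- The integrand of `Jfun`. -/
def Fint (lp lm : ℝ) (u : ℝ → ℝ → ℝ) (p : ℝ × ℝ) : ℝ :=
  (gradSq u p + (if 0 < u p.1 p.2 then lp else 0)
      + (if u p.1 p.2 < 0 then lm else 0)) * p.1

lemma PolLip.integrableOn_Fint {K : ℝ} {u : ℝ → ℝ → ℝ} (h : PolLip K u) (l lp lm : ℝ)
    (hlp : 0 < lp) (hlm : 0 < lm) :
    IntegrableOn (Fint lp lm u) (Ioo (0:ℝ) 1 ×ˢ Ioo (0:ℝ) l) := by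
  have hms : MeasurableSet (Ioo (0:ℝ) 1 ×ˢ Ioo (0:ℝ) l) := measurableSet_Ioo.prod measurableSet_Ioo
  have hfin : volume (Ioo (0:ℝ) 1 ×ˢ Ioo (0:ℝ) l) < ⊤ := by
    rw [Measure.volume_eq_prod, Measure.prod_prod]
    simp
  have hmeas : Measurable (Fint lp lm (fun s φ => u (PolLip.clamp s) φ)) := by
    unfold Fint
    have hc : Measurable fun p : ℝ × ℝ => u (PolLip.clamp p.1) p.2 := h.continuous_ext.measurable
    have hg := h.measurable_gradSq_ext
    refine Measurable.mul (Measurable.add (Measurable.add hg ?_) ?_) measurable_fst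
    · exact Measurable.ite (measurableSet_lt measurable_const hc) measurable_const measurable_const
    · exact Measurable.ite (measurableSet_lt hc measurable_const) measurable_const measurable_const
  have heq : EqOn (Fint lp lm (fun s φ => u (PolLip.clamp s) φ)) (Fint lp lm u)
      (Ioo (0:ℝ) 1 ×ˢ Ioo (0:ℝ) l) := by
    rintro ⟨r, θ⟩ ⟨hr, -⟩
    simp only at hr
    unfold Fint
    rw [PolLip.gradSq_ext hr]
    simp only [PolLip.clamp_eq (Ioo_subset_Icc_self hr)]
  refine IntegrableOn.congr_fun ?_ heq hms
  refine Measure.integrableOn_of_bounded (M := 2 * K ^ 2 + lp + lm) hfin.ne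
    hmeas.aestronglyMeasurable ?_
  filter_upwards [ae_restrict_mem hms] with p hp
  rw [heq hp]
  obtain ⟨r, θ⟩ := p
  obtain ⟨hr, -⟩ := hp
  simp only at hr
  have h1 := h.gradSq_le (θ := θ) hr
  have h0 := PolLip.gradSq_nonneg u (r, θ)
  unfold Fint
  simp only
  have hr0 : 0 < r := hr.1
  have a1 : 0 ≤ (if 0 < u r θ then lp else 0) := by split_ifs <;> linarith
  have a2 : 0 ≤ (if u r θ < 0 then lm else 0) := by split_ifs <;> linarith
  have b1 : (if 0 < u r θ then lp else 0) ≤ lp := by split_ifs <;> linarith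
  have b2 : (if u r θ < 0 then lm else 0) ≤ lm := by split_ifs <;> linarith
  rw [Real.norm_eq_abs, abs_of_nonneg (by positivity)]
  calc _ ≤ (gradSq u (r, θ) + (if 0 < u r θ then lp else 0) + (if u r θ < 0 then lm else 0)) * 1 := by
        apply mul_le_mul_of_nonneg_left hr.2.le (by positivity)
    _ ≤ _ := by linarith

/-! ### The radial barrier, the competitor and the test function -/

/-- The radial barrier. -/
def vbar (c ρ ε K r : ℝ) : ℝ := c * Real.log (max r ρ / ρ) + K * max (r - ε) 0

/-- Truncation of `u` at the levels `± v`. -/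
def wcomp (v : ℝ → ℝ) (u : ℝ → ℝ → ℝ) (r θ : ℝ) : ℝ := max (-(v r)) (min (u r θ) (v r))

/-- The one-dimensional test function. -/
def Phi (v : ℝ → ℝ) (ρ : ℝ) (U : ℝ → ℝ) (r : ℝ) : ℝ :=
  (min r ρ / ρ) * (min r ρ / ρ) * max (|U r| - v r) 0

lemma log_sub_log_le {x y : ℝ} (hx : 1 ≤ x) (hy : 1 ≤ y) :
    |Real.log x - Real.log y| ≤ |x - y| := by
  wlog hxy : y ≤ x generalizing x y
  · rw [abs_sub_comm, abs_sub_comm x y]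
    exact this hy hx (le_of_not_ge hxy)
  have hy0 : 0 < y := by linarith
  have hx0 : 0 < x := by linarith
  rw [abs_of_nonneg (sub_nonneg.2 hxy),
    abs_of_nonneg (sub_nonneg.2 (Real.log_le_log hy0 hxy)), ← Real.log_div hx0.ne' hy0.ne']
  have h1 := Real.log_le_sub_one_of_pos (div_pos hx0 hy0)
  have h2 : x / y - 1 = (x - y) / y := by field_simp
  have h3 : (x - y) / y ≤ x - y := div_le_self (by linarith) hy
  linarith

lemma vbar_lip {c ρ ε K : ℝ} (hc : 0 < c) (hρ : 0 < ρ) (hK : 0 ≤ K) (r s : ℝ) :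
    |vbar c ρ ε K r - vbar c ρ ε K s| ≤ (c / ρ + K) * |r - s| := by
  have hm : ∀ t : ℝ, 1 ≤ max t ρ / ρ := fun t => by
    rw [le_div_iff₀ hρ, one_mul]; exact le_max_right _ _
  have h1 := log_sub_log_le (hm r) (hm s)
  have h2 : |max r ρ / ρ - max s ρ / ρ| ≤ |r - s| / ρ := by
    rw [← sub_div, abs_div, abs_of_pos hρ]
    exact div_le_div_of_nonneg_right (abs_max_sub_max_le_abs r s ρ) hρ.le
  have h3 : |max (r - ε) 0 - max (s - ε) 0| ≤ |r - s| := by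
    have := abs_max_sub_max_le_abs (r - ε) (s - ε) 0
    simpa using this
  unfold vbar
  calc _ = |c * (Real.log (max r ρ / ρ) - Real.log (max s ρ / ρ))
        + K * (max (r - ε) 0 - max (s - ε) 0)| := by congr 1; ring
    _ ≤ |c * (Real.log (max r ρ / ρ) - Real.log (max s ρ / ρ))|
        + |K * (max (r - ε) 0 - max (s - ε) 0)| := abs_add_le _ _
    _ = c * |Real.log (max r ρ / ρ) - Real.log (max s ρ / ρ)|
        + K * |max (r - ε) 0 - max (s - ε) 0| := by
          rw [abs_mul, abs_mul, abs_of_pos hc, abs_of_nonneg hK]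
    _ ≤ c * (|r - s| / ρ) + K * |r - s| := by
          gcongr
          exact h1.trans h2
    _ = _ := by ring

lemma vbar_nonneg {c ρ ε K : ℝ} (hc : 0 < c) (hρ : 0 < ρ) (hK : 0 ≤ K) (r : ℝ) :
    0 ≤ vbar c ρ ε K r := by
  have : 1 ≤ max r ρ / ρ := by
    rw [le_div_iff₀ hρ, one_mul]; exact le_max_right _ _
  have := Real.log_nonneg this
  unfold vbar
  have := le_max_right (r - ε) 0
  positivity

lemma vbar_eq_zero {c ρ ε K r : ℝ} (hρ : 0 < ρ) (hρε : ρ ≤ ε) (hr : r ≤ ρ) :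
    vbar c ρ ε K r = 0 := by
  unfold vbar
  rw [max_eq_right hr, max_eq_right (by linarith : r - ε ≤ 0), div_self hρ.ne']
  simp

lemma vbar_mid {c ρ ε K r : ℝ} (hr : ρ ≤ r) (hr' : r ≤ ε) :
    vbar c ρ ε K r = c * Real.log (r / ρ) := by
  unfold vbar
  rw [max_eq_left hr, max_eq_right (by linarith : r - ε ≤ 0)]
  simp

lemma vbar_hasDerivAt {c ρ ε K r : ℝ} (hρ : 0 < ρ) (hr : ρ < r) (hr' : r < ε) :
    HasDerivAt (vbar c ρ ε K) (c / r) r := by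
  have hr0 : 0 < r := hρ.trans hr
  have h1 : HasDerivAt (fun s => c * Real.log (s / ρ)) (c / r) r := by
    have h2 := (((hasDerivAt_id r).div_const ρ).log (by simp only [id]; positivity)).const_mul c
    convert! h2 using 1
    simp only [id]
    field_simp
  refine h1.congr_of_eventuallyEq ?_
  filter_upwards [Ioo_mem_nhds hr hr'] with s hs
  exact vbar_mid hs.1.le hs.2.le

lemma wcomp_coneLip {l K K' : ℝ} {u : ℝ → ℝ → ℝ} {v : ℝ → ℝ}
    (hu : ConeLip l 1 u)
    (hK : ∀ p q : ℝ × ℝ, p.1 ∈ Set.Icc (0:ℝ) 1 → q.1 ∈ Set.Icc (0:ℝ) 1 →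
      |u p.1 p.2 - u q.1 q.2| ≤ K * coneDist l p q)
    (hK0 : 0 ≤ K) (hK' : 0 ≤ K') (hv : ∀ r s, |v r - v s| ≤ K' * |r - s|) :
    ConeLip l 1 (wcomp v u) := by
  constructor
  · intro r θ
    unfold wcomp
    rw [hu.periodic]
  · refine ⟨K + K', fun p q hp hq => ?_⟩
    have hd := coneDist_nonneg l p q
    have h1 : |u p.1 p.2 - u q.1 q.2| ≤ (K + K') * coneDist l p q := by
      refine (hK p q hp hq).trans ?_
      nlinarith
    have h2 : |v p.1 - v q.1| ≤ (K + K') * coneDist l p q := by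
      refine (hv _ _).trans ?_
      have := mul_le_mul_of_nonneg_left (abs_sub_le_coneDist l p q hp.1 hq.1) hK'
      nlinarith
    unfold wcomp
    refine (abs_max_sub_max_le_max _ _ _ _).trans (max_le ?_ ?_)
    · rw [neg_sub_neg, abs_sub_comm]; exact h2
    · exact (abs_min_sub_min_le_max _ _ _ _).trans (max_le h1 h2)

/-! ### One-dimensional calculus -/

lemma deriv_abs_facts {U : ℝ → ℝ} {r : ℝ} (hU : ContinuousAt U r) :
    (deriv (fun s => |U s|) r) ^ 2 ≤ (deriv U r) ^ 2 ∧
    (U r = 0 → deriv (fun s => |U s|) r = 0) := by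
  have h0 : U r = 0 → deriv (fun s => |U s|) r = 0 := by
    intro h
    apply IsLocalMin.deriv_eq_zero
    filter_upwards with s
    simp [h]
  refine ⟨?_, h0⟩
  rcases lt_trichotomy (U r) 0 with h | h | h
  · have : (fun s => |U s|) =ᶠ[nhds r] fun s => - U s := by
      filter_upwards [hU.eventually (gt_mem_nhds h)] with s hs
      exact abs_of_neg hs
    rw [this.deriv_eq, deriv.fun_neg]
    simp
  · rw [h0 h]; simpa using sq_nonneg (deriv U r)
  · have : (fun s => |U s|) =ᶠ[nhds r] U := by
      filter_upwards [hU.eventually (lt_mem_nhds h)] with s hs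
      exact abs_of_pos hs
    rw [this.deriv_eq]

lemma wcomp_of_le {v : ℝ → ℝ} {u : ℝ → ℝ → ℝ} {r θ : ℝ} (h : |u r θ| ≤ v r) :
    wcomp v u r θ = u r θ := by
  unfold wcomp
  rw [abs_le] at h
  rw [min_eq_left h.2, max_eq_right h.1]

lemma wcomp_abs_le {v : ℝ → ℝ} (u : ℝ → ℝ → ℝ) {r : ℝ} (θ : ℝ) (h : 0 ≤ v r) :
    -(v r) ≤ wcomp v u r θ ∧ wcomp v u r θ ≤ v r :=
  ⟨le_max_left _ _, max_le (by linarith) (min_le_right _ _)⟩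

/-- At points where `|u| ≥ v`, the gradient of the truncation is controlled by that of `v`. -/
lemma gradSq_wcomp_le {v : ℝ → ℝ} {u : ℝ → ℝ → ℝ} {r θ vd : ℝ} (hv0 : ∀ s, 0 ≤ v s)
    (hv : HasDerivAt v vd r) (h : v r ≤ |u r θ|) :
    gradSq (wcomp v u) (r, θ) ≤ vd ^ 2 := by
  have hcase : wcomp v u r θ = v r ∨ wcomp v u r θ = -(v r) := by
    rcases le_abs.1 h with h | h
    · left
      unfold wcomp
      rw [min_eq_right h, max_eq_right]
      linarith [hv0 r]
    · right
      unfold wcomp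
      rw [max_eq_left]
      exact (min_le_left _ _).trans (by linarith)
  have hang : deriv (fun φ => wcomp v u r φ) θ = 0 := by
    rcases hcase with h1 | h1
    · apply IsLocalMax.deriv_eq_zero
      filter_upwards with φ
      rw [h1]; exact (wcomp_abs_le u φ (hv0 r)).2
    · apply IsLocalMin.deriv_eq_zero
      filter_upwards with φ
      rw [h1]; exact (wcomp_abs_le u φ (hv0 r)).1
  unfold gradSq
  simp only
  rw [hang]
  simp only [ne_eq, OfNat.ofNat_ne_zero, not_false_eq_true, zero_pow, zero_div, add_zero]
  by_cases hd : DifferentiableAt ℝ (fun s => wcomp v u s θ) r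
  · rcases hcase with h1 | h1
    · have h2 : deriv (fun s => wcomp v u s θ - v s) r = 0 := by
        apply IsLocalMax.deriv_eq_zero
        filter_upwards with s
        have := (wcomp_abs_le u θ (hv0 s)).2
        linarith
      rw [(hd.hasDerivAt.fun_sub hv).deriv] at h2
      rw [sub_eq_zero.1 h2]
    · have h2 : deriv (fun s => wcomp v u s θ + v s) r = 0 := by
        apply IsLocalMin.deriv_eq_zero
        filter_upwards with s
        have := (wcomp_abs_le u θ (hv0 s)).1
        linarith
      rw [(hd.hasDerivAt.fun_add hv).deriv] at h2
      rw [eq_neg_of_add_eq_zero_left h2]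
      simp
  · rw [deriv_zero_of_not_differentiableAt hd]
    simpa using sq_nonneg vd

/-- If `w = u` near a point, the integrands agree. -/
lemma gradSq_congr {u w : ℝ → ℝ → ℝ} {r θ : ℝ} (h1 : ∀ᶠ s in nhds r, w s θ = u s θ)
    (h2 : ∀ᶠ φ in nhds θ, w r φ = u r φ) : gradSq w (r, θ) = gradSq u (r, θ) := by
  unfold gradSq
  simp only
  rw [Filter.EventuallyEq.deriv_eq (f₁ := fun s => w s θ) (f := fun s => u s θ) h1,
    Filter.EventuallyEq.deriv_eq (f₁ := fun φ => w r φ) (f := fun φ => u r φ) h2]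

lemma wcomp_ind_le {lp lm : ℝ} (hlp : 0 < lp) (hlm : 0 < lm) {v : ℝ → ℝ} {u : ℝ → ℝ → ℝ}
    {r θ : ℝ} (hv : 0 ≤ v r) :
    (if 0 < wcomp v u r θ then lp else 0) ≤ (if 0 < u r θ then lp else 0) ∧
    (if wcomp v u r θ < 0 then lm else 0) ≤ (if u r θ < 0 then lm else 0) := by
  have h1 : 0 < wcomp v u r θ → 0 < u r θ := by
    unfold wcomp
    intro h
    rcases lt_max_iff.1 h with h | h
    · linarith
    · exact (lt_min_iff.1 h).1
  have h2 : wcomp v u r θ < 0 → u r θ < 0 := by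
    unfold wcomp
    intro h
    rcases min_lt_iff.1 (max_lt_iff.1 h).2 with h | h
    · exact h
    · linarith
  constructor <;> split_ifs <;> first | linarith | tauto

lemma Phi_ac {K K' ρ : ℝ} {v U : ℝ → ℝ} (hK : 0 ≤ K) (hK' : 0 ≤ K') (hρ : 0 < ρ)
    (hU : ∀ r ∈ Icc (0:ℝ) 1, ∀ s ∈ Icc (0:ℝ) 1, |U r - U s| ≤ K * |r - s|)
    (hv : ∀ r s, |v r - v s| ≤ K' * |r - s|) :
    AbsolutelyContinuousOnInterval (Phi v ρ U) 0 1 := by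
  have h1 : AbsolutelyContinuousOnInterval (fun r => min r ρ / ρ) 0 1 := by
    have : LipschitzOnWith (Real.toNNReal (1 / ρ)) (fun r : ℝ => min r ρ / ρ) (uIcc 0 1) := by
      apply LipschitzOnWith.of_dist_le_mul
      intro x _ y _
      rw [Real.coe_toNNReal _ (by positivity), Real.dist_eq, Real.dist_eq, ← sub_div, abs_div,
        abs_of_pos hρ, one_div, div_eq_inv_mul]
      refine mul_le_mul_of_nonneg_left ?_ (by positivity)
      have := abs_min_sub_min_le_max x ρ y ρ
      simpa only [sub_self, abs_zero, max_eq_left (abs_nonneg (x - y))] using this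
    exact this.absolutelyContinuousOnInterval
  have h2 : AbsolutelyContinuousOnInterval (fun r => max (|U r| - v r) 0) 0 1 := by
    have : LipschitzOnWith (Real.toNNReal (K + K')) (fun r : ℝ => max (|U r| - v r) 0)
        (uIcc 0 1) := by
      apply LipschitzOnWith.of_dist_le_mul
      intro x hx y hy
      rw [uIcc_of_le zero_le_one] at hx hy
      rw [Real.coe_toNNReal _ (by positivity), Real.dist_eq, Real.dist_eq]
      refine (abs_max_sub_max_le_abs _ _ _).trans ?_
      have a1 := (abs_abs_sub_abs_le (U x) (U y)).trans (hU x hx y hy)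
      have a2 := hv x y
      calc _ = |(|U x| - |U y|) - (v x - v y)| := by congr 1; ring
        _ ≤ |(|U x| - |U y|)| + |v x - v y| := abs_sub _ _
        _ ≤ _ := by linarith
    exact this.absolutelyContinuousOnInterval
  exact (h1.mul h1).mul h2

/-- The key pointwise inequality. -/
lemma pointwise_key {lp lm lam c ρ ε K : ℝ} {u : ℝ → ℝ → ℝ}
    (hlp : 0 < lp) (hlm : 0 < lm) (hlamp : lam ≤ lp) (hlamm : lam ≤ lm)
    (hc : 0 < c) (hρ : 0 < ρ) (hρε : ρ < ε) (hε1 : ε < 1)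
    (hc1 : 2 * c ≤ ρ ^ 2) (hc2 : 12 * c ≤ lam * ρ ^ 2)
    (hu : PolLip K u) {θ : ℝ} (hb1 : ∀ r ∈ Icc (0:ℝ) ε, |u r θ| ≤ 1)
    (hbig : ∀ r ∈ Icc ε 1, ∀ φ, |u r φ| ≤ vbar c ρ ε K r)
    {r : ℝ} (hr : r ∈ Ioo (0:ℝ) 1) (hrρ : r ≠ ρ) (hrε : r ≠ ε)
    (hA : DifferentiableAt ℝ (fun s => |u s θ|) r)
    (hP : DifferentiableAt ℝ (Phi (vbar c ρ ε K) ρ (fun s => u s θ)) r) :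
    (if r < ρ ∧ u r θ ≠ 0 then lam / 2 * r else 0)
      + 2 * c * deriv (Phi (vbar c ρ ε K) ρ (fun s => u s θ)) r
      ≤ Fint lp lm u (r, θ) - Fint lp lm (wcomp (vbar c ρ ε K) u) (r, θ) := by
  have hK := hu.nonneg
  have hr0 : 0 < r := hr.1
  set v := vbar c ρ ε K with hv
  have hv0 : ∀ s, 0 ≤ v s := vbar_nonneg hc hρ hK
  have hUc : ContinuousAt (fun s => u s θ) r := hu.continuousAt_rad hr θ
  obtain ⟨hAsq, hA0⟩ := deriv_abs_facts hUc
  have hAcont : ContinuousAt (fun s => |u s θ|) r := hA.continuousAt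
  have hind := wcomp_ind_le hlp hlm (u := u) (θ := θ) (hv0 r)
  have hgr : (deriv (fun s => u s θ) r) ^ 2 ≤ gradSq u (r, θ) := by
    unfold gradSq
    simp only
    have : 0 ≤ (deriv (fun φ => u r φ) θ) ^ 2 / r ^ 2 := by positivity
    linarith
  set a := deriv (fun s => |u s θ|) r with ha
  rcases lt_or_gt_of_ne hrρ with h | h
  · -- inner ball
    have hw1 : ∀ s < ρ, ∀ φ, wcomp v u s φ = 0 := by
      intro s hs φ
      have hz : v s = 0 := vbar_eq_zero hρ hρε.le hs.le
      have := wcomp_abs_le u φ (hv0 s)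
      rw [hz] at this
      linarith [this.1, this.2]
    have hFw : Fint lp lm (wcomp v u) (r, θ) = 0 := by
      have hg : gradSq (wcomp v u) (r, θ) = gradSq (fun _ _ => 0) (r, θ) := by
        apply gradSq_congr
        · filter_upwards [gt_mem_nhds h] with s hs using hw1 s hs θ
        · filter_upwards with φ using hw1 r h φ
      unfold Fint
      rw [hg]
      simp only [hw1 r h θ]
      simp [gradSq]
    have hPhi : HasDerivAt (Phi v ρ (fun s => u s θ))
        ((2 * r / ρ ^ 2) * |u r θ| + r ^ 2 / ρ ^ 2 * a) r := by
      have h1 : HasDerivAt (fun s : ℝ => s ^ 2 / ρ ^ 2) (2 * r / ρ ^ 2) r := by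
        simpa using (hasDerivAt_pow 2 r).div_const (ρ ^ 2)
      have h2 := h1.fun_mul hA.hasDerivAt
      refine h2.congr_of_eventuallyEq ?_
      filter_upwards [gt_mem_nhds h] with s hs
      have hs' : s < ρ := hs
      unfold Phi
      rw [min_eq_left hs'.le, hv, vbar_eq_zero hρ hρε.le hs'.le, sub_zero,
        max_eq_left (abs_nonneg _)]
      ring
    rw [hPhi.deriv, hFw, sub_zero]
    by_cases hz : u r θ = 0
    · rw [if_neg (by tauto), hA0 hz, hz]
      have hpos : 0 ≤ Fint lp lm u (r, θ) := by
        unfold Fint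
        have := PolLip.gradSq_nonneg u (r, θ)
        simp only [hz]
        simp
        positivity
      simpa using hpos
    · rw [if_pos ⟨h, hz⟩]
      have hF : (a ^ 2 + lam) * r ≤ Fint lp lm u (r, θ) := by
        unfold Fint
        apply mul_le_mul_of_nonneg_right _ hr0.le
        simp only
        rcases lt_or_gt_of_ne hz with h' | h'
        · rw [if_neg (by linarith), if_pos h']; linarith
        · rw [if_pos h', if_neg (by linarith)]; linarith
      refine le_trans ?_ hF
      have hu1 := hb1 r ⟨hr0.le, by linarith⟩
      have hra : r * a ≤ 1 + a ^ 2 := by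
        nlinarith [sq_nonneg (r - a), hr.2, sq_nonneg a]
      have hk : 2 * c * (2 * r / ρ ^ 2 * |u r θ| + r ^ 2 / ρ ^ 2 * a)
          = (2 * c / ρ ^ 2) * (2 * |u r θ| + r * a) * r := by
        field_simp
      rw [hk, ← add_mul]
      apply mul_le_mul_of_nonneg_right _ hr0.le
      have hq1 : 2 * c / ρ ^ 2 ≤ 1 := by rw [div_le_one (by positivity)]; exact hc1
      have hq2 : 2 * c / ρ ^ 2 ≤ lam / 6 := by
        rw [div_le_iff₀ (by positivity)]; linarith
      have hq0 : 0 < 2 * c / ρ ^ 2 := by positivity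
      have : (2 * c / ρ ^ 2) * (2 * |u r θ| + r * a) ≤ (2 * c / ρ ^ 2) * (3 + a ^ 2) := by
        apply mul_le_mul_of_nonneg_left _ hq0.le
        linarith
      nlinarith [sq_nonneg a]
  · rw [if_neg (by intro hh; linarith [hh.1]), zero_add]
    -- a common consequence of `|u| < v` nearby
    have hclose : (∀ᶠ s in nhds r, |u s θ| ≤ v s) → (∀ᶠ φ in nhds θ, |u r φ| ≤ v r) →
        2 * c * deriv (Phi v ρ (fun s => u s θ)) r
          ≤ Fint lp lm u (r, θ) - Fint lp lm (wcomp v u) (r, θ) := by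
      intro h1 h2
      have hd : deriv (Phi v ρ (fun s => u s θ)) r = 0 := by
        have : Phi v ρ (fun s => u s θ) =ᶠ[nhds r] fun _ => 0 := by
          filter_upwards [h1] with s hs
          unfold Phi
          rw [max_eq_right (by linarith), mul_zero]
        rw [this.deriv_eq, deriv_const]
      have hg : gradSq (wcomp v u) (r, θ) = gradSq u (r, θ) := by
        apply gradSq_congr
        · filter_upwards [h1] with s hs using wcomp_of_le hs
        · filter_upwards [h2] with s hs using wcomp_of_le hs
      have hx : wcomp v u r θ = u r θ := wcomp_of_le h1.self_of_nhds
      unfold Fint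
      rw [hd, hg]
      simp only [hx]
      simp
    have hvcont : Continuous v := by
      have : LipschitzWith (Real.toNNReal (c / ρ + K)) v := by
        apply LipschitzWith.of_dist_le_mul
        intro x y
        rw [Real.coe_toNNReal _ (by positivity), Real.dist_eq, Real.dist_eq]
        exact vbar_lip hc hρ hK x y
      exact this.continuous
    rcases lt_or_gt_of_ne hrε with hlt_eps | hgt_eps
    · -- annulus
      rcases lt_or_ge (|u r θ|) (v r) with hlt | hge
      · apply hclose
        · have := hAcont.eventually_lt hvcont.continuousAt hlt
          filter_upwards [this] with s hs using hs.le
        · have h3 : Continuous fun φ => |u r φ| :=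
            (hu.continuous_ang (Ioo_subset_Icc_self hr)).abs
          have := h3.continuousAt.eventually_lt (continuousAt_const (x := θ)) hlt
          filter_upwards [this] with s hs using hs.le
      · have hvd : HasDerivAt v (c / r) r := vbar_hasDerivAt hρ h hlt_eps
        have hgw := gradSq_wcomp_le hv0 hvd hge
        have hd : deriv (Phi v ρ (fun s => u s θ)) r = a - c / r := by
          have hloc : ∀ᶠ s in nhds r, Phi v ρ (fun s => u s θ) s = max (|u s θ| - v s) 0 := by
            filter_upwards [lt_mem_nhds h] with s hs
            have hs' : ρ < s := hs
            unfold Phi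
            rw [min_eq_right hs'.le, div_self hρ.ne', one_mul, one_mul]
          have h2 : deriv (fun s => Phi v ρ (fun s => u s θ) s - (|u s θ| - v s)) r = 0 := by
            apply IsLocalMin.deriv_eq_zero
            filter_upwards [hloc] with s hs
            rw [hs, hloc.self_of_nhds, max_eq_left (by linarith)]
            have := le_max_left (|u s θ| - v s) 0
            linarith
          rw [(hP.hasDerivAt.fun_sub (hA.hasDerivAt.fun_sub hvd)).deriv] at h2
          exact sub_eq_zero.1 h2
        rw [hd]
        have hmain : (2 * (c / r) * a - 2 * (c / r) ^ 2) * r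
            ≤ Fint lp lm u (r, θ) - Fint lp lm (wcomp v u) (r, θ) := by
          unfold Fint
          rw [← sub_mul]
          apply mul_le_mul_of_nonneg_right _ hr0.le
          simp only
          nlinarith [hind.1, hind.2, sq_nonneg (a - c / r)]
        refine le_trans (le_of_eq ?_) hmain
        field_simp
    · -- outside
      apply hclose
      · filter_upwards [Ioo_mem_nhds hgt_eps hr.2] with s hs
        exact hbig s ⟨hs.1.le, hs.2.le⟩ θ
      · filter_upwards with φ
        exact hbig r ⟨hgt_eps.le, hr.2.le⟩ φ

/-- The inequality integrated along a ray. -/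
lemma line_key {lp lm lam c ρ ε K : ℝ} {u : ℝ → ℝ → ℝ}
    (hlp : 0 < lp) (hlm : 0 < lm) (hlamp : lam ≤ lp) (hlamm : lam ≤ lm)
    (hc : 0 < c) (hρ : 0 < ρ) (hρε : ρ < ε) (hε1 : ε < 1)
    (hc1 : 2 * c ≤ ρ ^ 2) (hc2 : 12 * c ≤ lam * ρ ^ 2)
    (hu : PolLip K u) {θ : ℝ} (hb1 : ∀ r ∈ Icc (0:ℝ) ε, |u r θ| ≤ 1)
    (hbig : ∀ r ∈ Icc ε 1, ∀ φ, |u r φ| ≤ vbar c ρ ε K r)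
    (hH : IntegrableOn (fun r => if r < ρ ∧ u r θ ≠ 0 then lam / 2 * r else 0) (Ioo (0:ℝ) 1))
    (hF : IntegrableOn (fun r => Fint lp lm u (r, θ) - Fint lp lm (wcomp (vbar c ρ ε K) u) (r, θ))
      (Ioo (0:ℝ) 1)) :
    ∫ r in Ioo (0:ℝ) 1, (if r < ρ ∧ u r θ ≠ 0 then lam / 2 * r else 0)
      ≤ ∫ r in Ioo (0:ℝ) 1,
        (Fint lp lm u (r, θ) - Fint lp lm (wcomp (vbar c ρ ε K) u) (r, θ)) := by
  have hK := hu.nonneg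
  have hac : AbsolutelyContinuousOnInterval
      (Phi (vbar c ρ ε K) ρ (fun s => u s θ)) 0 1 :=
    Phi_ac hK (K' := c / ρ + K) (by positivity) hρ
      (fun r hr s hs => hu.rad r hr s hs θ) (fun r s => vbar_lip hc hρ hK r s)
  have hAac : AbsolutelyContinuousOnInterval (fun s => |u s θ|) 0 1 := by
    have : LipschitzOnWith (Real.toNNReal K) (fun s => |u s θ|) (uIcc 0 1) := by
      apply LipschitzOnWith.of_dist_le_mul
      intro x hx y hy
      rw [uIcc_of_le zero_le_one] at hx hy
      rw [Real.coe_toNNReal _ hK, Real.dist_eq, Real.dist_eq]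
      exact (abs_abs_sub_abs_le _ _).trans (hu.rad x hx y hy θ)
    exact this.absolutelyContinuousOnInterval
  have hint : ∫ r in Ioo (0:ℝ) 1, deriv (Phi (vbar c ρ ε K) ρ (fun s => u s θ)) r = 0 := by
    rw [← integral_Ioc_eq_integral_Ioo, ← intervalIntegral.integral_of_le zero_le_one,
      hac.integral_deriv_eq_sub]
    have h1 := hbig 1 ⟨hε1.le, le_rfl⟩ θ
    unfold Phi
    rw [max_eq_right (by linarith : |u 1 θ| - vbar c ρ ε K 1 ≤ 0), min_eq_left hρ.le]
    simp
  have hPint : IntegrableOn (deriv (Phi (vbar c ρ ε K) ρ (fun s => u s θ))) (Ioo (0:ℝ) 1) := by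
    have := hac.intervalIntegrable_deriv
    rw [intervalIntegrable_iff_integrableOn_Ioo_of_le zero_le_one] at this
    exact this
  have hsum : ∫ r in Ioo (0:ℝ) 1, ((if r < ρ ∧ u r θ ≠ 0 then lam / 2 * r else 0)
      + 2 * c * deriv (Phi (vbar c ρ ε K) ρ (fun s => u s θ)) r)
      = ∫ r in Ioo (0:ℝ) 1, (if r < ρ ∧ u r θ ≠ 0 then lam / 2 * r else 0) := by
    rw [integral_add hH (hPint.const_mul _), integral_const_mul, hint, mul_zero, add_zero]
  rw [← hsum]
  refine integral_mono_ae (hH.add (hPint.const_mul _)) hF ?_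
  have hne : ∀ x : ℝ, ∀ᵐ r ∂(volume.restrict (Ioo (0:ℝ) 1)), r ≠ x := fun x =>
    ae_restrict_of_ae (Measure.ae_ne volume x)
  filter_upwards [ae_restrict_mem measurableSet_Ioo, hne ρ, hne ε,
    ae_restrict_of_ae hac.ae_differentiableAt, ae_restrict_of_ae hAac.ae_differentiableAt]
    with r hr h1 h2 h3 h4
  have hrI : r ∈ uIcc (0:ℝ) 1 := by
    rw [uIcc_of_le zero_le_one]; exact Ioo_subset_Icc_self hr
  exact pointwise_key hlp hlm hlamp hlamm hc hρ hρε hε1 hc1 hc2 hu hb1 hbig hr h1 h2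
    (h4 hrI) (h3 hrI)

/-- Non-degeneracy at the vertex: for `λ₊, λ₋ > 0` and `ε ∈ (0,1)` there is
`δ = δ(l, λ₊, λ₋, ε) > 0` such that every minimizer `u` of `J(C_1, λ₊, λ₋)` with
`|u| < δ` on `C_ε` vanishes identically on `C_{ε/2}`. -/
theorem nondegeneracy_at_vertex (l lp lm ε : ℝ) (hl : 0 < l)
    (hlp : 0 < lp) (hlm : 0 < lm) (hε : ε ∈ Set.Ioo (0:ℝ) 1) :
    ∃ δ > (0:ℝ), ∀ u : ℝ → ℝ → ℝ, IsMinimizerJ l lp lm 1 u →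
      (∀ r ∈ Set.Icc (0:ℝ) ε, ∀ θ : ℝ, |u r θ| < δ) →
      ∀ r ∈ Set.Icc (0:ℝ) (ε / 2), ∀ θ : ℝ, u r θ = 0 := by
  obtain ⟨hε0, hε1⟩ := hε
  set ρ := ε / 2 with hρdef
  have hρ : 0 < ρ := by positivity
  have hρε : ρ < ε := by linarith
  set lam := min lp lm with hlam
  have hlam0 : 0 < lam := lt_min hlp hlm
  set c := min (1 / 2) (lam / 12) * ρ ^ 2 with hcdef
  have hc : 0 < c := by positivity
  have hc1 : 2 * c ≤ ρ ^ 2 := by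
    have : c ≤ 1 / 2 * ρ ^ 2 := by rw [hcdef]; gcongr; exact min_le_left _ _
    linarith
  have hc2 : 12 * c ≤ lam * ρ ^ 2 := by
    have : c ≤ lam / 12 * ρ ^ 2 := by rw [hcdef]; gcongr; exact min_le_right _ _
    linarith
  have hlog0 : 0 < Real.log 2 := Real.log_pos one_lt_two
  have hlog1 : Real.log 2 ≤ 1 := by
    have := Real.log_le_sub_one_of_pos (x := 2) two_pos
    linarith
  refine ⟨c * Real.log 2, by positivity, ?_⟩
  intro u hmin hsmall
  obtain ⟨hcl, hmin⟩ := hmin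
  obtain ⟨K, hu, hK⟩ := hcl.exists_polLip
  have hK0 := hu.nonneg
  have hδ1 : c * Real.log 2 ≤ 1 := by
    have : ρ ^ 2 ≤ 1 := by
      have : ρ ≤ 1 := by linarith
      exact pow_le_one₀ hρ.le this
    nlinarith
  have hb1 : ∀ θ, ∀ r ∈ Icc (0:ℝ) ε, |u r θ| ≤ 1 := fun θ r hr =>
    (hsmall r hr θ).le.trans hδ1
  have hbig : ∀ r ∈ Icc ε 1, ∀ φ, |u r φ| ≤ vbar c ρ ε K r := by
    intro r hr φ
    have h1 := hu.rad r ⟨hε0.le.trans hr.1, hr.2⟩ ε ⟨hε0.le, hε1.le⟩ φ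
    have h2 := (hsmall ε ⟨hε0.le, le_rfl⟩ φ).le
    rw [abs_of_nonneg (sub_nonneg.2 hr.1)] at h1
    have h3 : |u r φ| ≤ |u r φ - u ε φ| + |u ε φ| := by
      have := abs_add_le (u r φ - u ε φ) (u ε φ)
      simpa using this
    unfold vbar
    rw [max_eq_left (hρε.le.trans hr.1), max_eq_left (sub_nonneg.2 hr.1)]
    have h4 : Real.log 2 ≤ Real.log (r / ρ) := by
      apply Real.log_le_log two_pos
      rw [le_div_iff₀ hρ]
      linarith [hr.1]
    have h5 : c * Real.log 2 ≤ c * Real.log (r / ρ) := by gcongr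
    linarith
  set w := wcomp (vbar c ρ ε K) u with hw
  have hwcl : ConeLip l 1 w :=
    wcomp_coneLip hcl hK hK0 (K' := c / ρ + K) (by positivity) (fun r s => vbar_lip hc hρ hK0 r s)
  have hJ := hmin w hwcl (fun θ => wcomp_of_le (hbig 1 ⟨hε1.le, le_rfl⟩ θ))
  obtain ⟨Kw, hwp, -⟩ := hwcl.exists_polLip
  have hIu := hu.integrableOn_Fint l lp lm hlp hlm
  have hIw := hwp.integrableOn_Fint l lp lm hlp hlm
  have hdiff : ∫ p in Ioo (0:ℝ) 1 ×ˢ Ioo (0:ℝ) l, (Fint lp lm u p - Fint lp lm w p) ≤ 0 := by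
    rw [integral_sub hIu hIw]
    have h1 : Jfun l lp lm u 1 = ∫ p in Ioo (0:ℝ) 1 ×ˢ Ioo (0:ℝ) l, Fint lp lm u p := rfl
    have h2 : Jfun l lp lm w 1 = ∫ p in Ioo (0:ℝ) 1 ×ˢ Ioo (0:ℝ) l, Fint lp lm w p := rfl
    rw [h1, h2] at hJ
    linarith
  -- the positive remainder
  set H : ℝ × ℝ → ℝ := fun p => if p.1 < ρ ∧ u p.1 p.2 ≠ 0 then lam / 2 * p.1 else 0 with hHdef
  have hms : MeasurableSet (Ioo (0:ℝ) 1 ×ˢ Ioo (0:ℝ) l) := measurableSet_Ioo.prod measurableSet_Ioo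
  have hH0 : ∀ p ∈ Ioo (0:ℝ) 1 ×ˢ Ioo (0:ℝ) l, 0 ≤ H p := by
    rintro p ⟨hp, -⟩
    have := hp.1
    simp only [hHdef]
    split_ifs
    · positivity
    · exact le_rfl
  have hHint : IntegrableOn H (Ioo (0:ℝ) 1 ×ˢ Ioo (0:ℝ) l) := by
    have hfin : volume (Ioo (0:ℝ) 1 ×ˢ Ioo (0:ℝ) l) < ⊤ := by
      rw [Measure.volume_eq_prod, Measure.prod_prod]
      simp
    set H' : ℝ × ℝ → ℝ := fun p =>
      if p.1 < ρ ∧ u (PolLip.clamp p.1) p.2 ≠ 0 then lam / 2 * p.1 else 0 with hH'def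
    have hc' : Measurable fun p : ℝ × ℝ => u (PolLip.clamp p.1) p.2 := hu.continuous_ext.measurable
    have hmeas : Measurable H' := by
      refine Measurable.ite ?_ (measurable_fst.const_mul _) measurable_const
      exact (measurableSet_lt measurable_fst measurable_const).inter
        (hc' (measurableSet_singleton (0:ℝ)).compl)
    have heq : EqOn H' H (Ioo (0:ℝ) 1 ×ˢ Ioo (0:ℝ) l) := by
      rintro ⟨r, θ⟩ ⟨hr, -⟩
      simp only at hr
      simp only [hH'def, hHdef, PolLip.clamp_eq (Ioo_subset_Icc_self hr)]
    refine IntegrableOn.congr_fun ?_ heq hms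
    refine Measure.integrableOn_of_bounded (M := lam / 2) hfin.ne hmeas.aestronglyMeasurable ?_
    filter_upwards [ae_restrict_mem hms] with p hp
    rw [heq hp, Real.norm_eq_abs, abs_of_nonneg (hH0 p hp)]
    simp only [hHdef]
    have := hp.1.2
    split_ifs
    · nlinarith
    · positivity
  have hprod : (volume : Measure (ℝ × ℝ)).restrict (Ioo (0:ℝ) 1 ×ˢ Ioo (0:ℝ) l)
      = (volume.restrict (Ioo (0:ℝ) 1)).prod (volume.restrict (Ioo (0:ℝ) l)) := by
    rw [Measure.volume_eq_prod, Measure.prod_restrict]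
  have hDint : IntegrableOn (fun p => Fint lp lm u p - Fint lp lm w p)
      (Ioo (0:ℝ) 1 ×ˢ Ioo (0:ℝ) l) := hIu.sub hIw
  have hle : ∫ p in Ioo (0:ℝ) 1 ×ˢ Ioo (0:ℝ) l, H p
      ≤ ∫ p in Ioo (0:ℝ) 1 ×ˢ Ioo (0:ℝ) l, (Fint lp lm u p - Fint lp lm w p) := by
    unfold IntegrableOn at hHint hDint
    rw [hprod] at hHint hDint ⊢
    rw [integral_prod_symm _ hHint, integral_prod_symm _ hDint]
    refine integral_mono_ae hHint.integral_prod_right hDint.integral_prod_right ?_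
    filter_upwards [hHint.prod_left_ae, hDint.prod_left_ae] with θ h1 h2
    exact line_key hlp hlm (min_le_left _ _) (min_le_right _ _) hc hρ hρε hε1 hc1 hc2 hu
      (hb1 θ) hbig h1 h2
  have hH00 : ∫ p in Ioo (0:ℝ) 1 ×ˢ Ioo (0:ℝ) l, H p = 0 :=
    le_antisymm (hle.trans hdiff) (setIntegral_nonneg hms hH0)
  have hae : ∀ᵐ p ∂(volume.restrict (Ioo (0:ℝ) 1 ×ˢ Ioo (0:ℝ) l)), H p = 0 := by
    have := (integral_eq_zero_iff_of_nonneg_ae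
      (by filter_upwards [ae_restrict_mem hms] with p hp using hH0 p hp) hHint).1 hH00
    exact this
  have hsub : Ioo (0:ℝ) ρ ×ˢ Ioo (0:ℝ) l ⊆ Ioo (0:ℝ) 1 ×ˢ Ioo (0:ℝ) l :=
    prod_mono (Ioo_subset_Ioo_right (by linarith)) subset_rfl
  have hae2 : (fun p : ℝ × ℝ => u p.1 p.2) =ᵐ[volume.restrict (Ioo (0:ℝ) ρ ×ˢ Ioo (0:ℝ) l)]
      fun _ => 0 := by
    filter_upwards [ae_restrict_of_ae_restrict_of_subset hsub hae,
      ae_restrict_mem (measurableSet_Ioo.prod measurableSet_Ioo)] with p hp hmem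
    by_contra hne
    simp only [hHdef] at hp
    rw [if_pos ⟨hmem.1.2, hne⟩] at hp
    have := hmem.1.1
    have : 0 < lam / 2 * p.1 := by positivity
    linarith
  have hcont : ContinuousOn (fun p : ℝ × ℝ => u p.1 p.2) (Icc (0:ℝ) ρ ×ˢ Icc (0:ℝ) l) :=
    hu.continuousOn.mono (prod_mono (Icc_subset_Icc_right (by linarith)) (subset_univ _))
  have hopen : EqOn (fun p : ℝ × ℝ => u p.1 p.2) (fun _ => 0) (Ioo (0:ℝ) ρ ×ˢ Ioo (0:ℝ) l) :=
    Measure.eqOn_open_of_ae_eq hae2 (isOpen_Ioo.prod isOpen_Ioo)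
      (hcont.mono (prod_mono Ioo_subset_Icc_self Ioo_subset_Icc_self)) continuousOn_const
  have hclosed : EqOn (fun p : ℝ × ℝ => u p.1 p.2) (fun _ => 0) (Icc (0:ℝ) ρ ×ˢ Icc (0:ℝ) l) := by
    refine hopen.of_subset_closure hcont continuousOn_const
      (prod_mono Ioo_subset_Icc_self Ioo_subset_Icc_self) ?_
    rw [closure_prod_eq, closure_Ioo hρ.ne, closure_Ioo hl.ne]
  intro r hr θ
  have hper : Function.Periodic (fun φ => u r φ) l := fun φ => hcl.periodic r φ
  obtain ⟨φ, hφ, hφe⟩ := hper.exists_mem_Ico₀ hl θ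
  have := hclosed (show (r, φ) ∈ Icc (0:ℝ) ρ ×ˢ Icc (0:ℝ) l from ⟨hr, Ico_subset_Icc_self hφ⟩)
  simp only at this hφe
  rw [hφe, this]
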